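/- arXiv:1602.05937 — 2 statements merged into one kernel-verified Lean document; each statement's English description precedes it below -/
import Mathlib

section
/- Let 0 ≤ α ≤ 1 and let (G_n,d_n) be an α-regular sequence of admissible pairs with v(G_n) ≥ 1 and d_n → ∞, which has large girth, meaning that for every k ≥ 3 there exists n_0(k) such that G_n contains no cycle of length k for all n ≥ n_0(k). For a graph G let w_k(G) denote the number of closed walks of length k in G, i.e., the trace of the k-th power of the adjacency matrix of G. Then for every integer k ≥ 1: if k is odd, w_k(G_n)/(v(G_n)·d_n^{k/2}) → 0 as n → ∞, and if k is even, w_k(G_n)/(v(G_n)·d_n^{k/2}) → α^{k/2}·(1/(k/2+1))·binom(k, k/2), i.e., α^{k/2} times the (k/2)-th Catalan number. -/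
open Filter Topology

noncomputable def homCount {α β : Type*} (F : SimpleGraph α) (G : SimpleGraph β) : ℕ :=
  Nat.card (F →g G)

noncomputable def injCount {α β : Type*} (F : SimpleGraph α) (G : SimpleGraph β) : ℕ :=
  Nat.card {f : F →g G // Function.Injective f}

noncomputable def vdegree {α : Type*} (G : SimpleGraph α) (x : α) : ℕ :=
  Nat.card (G.neighborSet x)

noncomputable def edgeCount {α : Type*} (G : SimpleGraph α) : ℕ := Nat.card G.edgeSet

noncomputable def numComponents {α : Type*} (F : SimpleGraph α) : ℕ :=
  Nat.card F.ConnectedComponent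

noncomputable def numBigComponents {α : Type*} (F : SimpleGraph α) : ℕ :=
  Nat.card {c : F.ConnectedComponent // 2 ≤ Nat.card c.supp}

def Admissible {α : Type*} (G : SimpleGraph α) (d : ℝ) : Prop :=
  1 ≤ d ∧ ∀ x : α, (vdegree G x : ℝ) ≤ d

noncomputable def homDensity {α β : Type*} (F : SimpleGraph α) (G : SimpleGraph β) (d : ℝ) : ℝ :=
  (homCount F G : ℝ) /
    ((Nat.card β : ℝ) ^ numComponents F * d ^ (Nat.card α - numComponents F))

noncomputable def injDensity {α β : Type*} (F : SimpleGraph α) (G : SimpleGraph β) (d : ℝ) : ℝ :=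
  (injCount F G : ℝ) /
    ((Nat.card β : ℝ) ^ numComponents F * d ^ numBigComponents F *
      (d - 1) ^ (Nat.card α - numComponents F - numBigComponents F))

open scoped Classical in
/-- The real adjacency matrix of a simple graph. -/
noncomputable def adjMat {V : Type*} (G : SimpleGraph V) : Matrix V V ℝ :=
  Matrix.of fun x y => if G.Adj x y then (1 : ℝ) else 0

/-- The number of closed walks of length `k` in `G`, as the trace of the `k`-th power of
the adjacency matrix. -/
noncomputable def closedWalkCount {V : Type*} [Fintype V] [DecidableEq V] (G : SimpleGraph V) (k : ℕ) : ℝ :=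
  Matrix.trace (adjMat G ^ k)

/-- A sequence of admissible pairs `(Gₙ, dₙ)` is `α`-regular. -/
def AlphaRegular (V : ℕ → Type) [∀ n, Fintype (V n)] (G : ∀ n, SimpleGraph (V n))
    (d : ℕ → ℝ) (α : ℝ) : Prop :=
  ∀ ε : ℝ, 0 < ε →
    Tendsto (fun n =>
        (Nat.card {x : V n // ε ≤ |(vdegree (G n) x : ℝ) / d n - α|} : ℝ) /
          (Nat.card (V n) : ℝ))
      atTop (𝓝 0)

open Finset.HasAntidiagonal (antidiagonal mem_antidiagonal)

/-- The limiting normalized number of closed walks: `α ^ (k / 2)` times the Catalan number of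
`k / 2` for even `k`, and `0` for odd `k`. -/
noncomputable def semicircleMoment (α : ℝ) (k : ℕ) : ℝ :=
  if Even k then α ^ (k / 2) * (catalan (k / 2) : ℝ) else 0

theorem semicircleMoment_two_mul (α : ℝ) (m : ℕ) :
    semicircleMoment α (2 * m) = α ^ m * (catalan m : ℝ) := by
  simp [semicircleMoment]

theorem semicircleMoment_of_odd (α : ℝ) {k : ℕ} (hk : Odd k) : semicircleMoment α k = 0 := by
  simp [semicircleMoment, Nat.not_even_iff_odd.2 hk]

theorem semicircleMoment_zero (α : ℝ) : semicircleMoment α 0 = 1 := by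
  simp [semicircleMoment]

theorem semicircleMoment_one (α : ℝ) : semicircleMoment α 1 = 0 := by
  simp [semicircleMoment]

theorem semicircleMoment_nonneg {α : ℝ} (hα : 0 ≤ α) (k : ℕ) : 0 ≤ semicircleMoment α k := by
  unfold semicircleMoment
  split_ifs <;> positivity

theorem semicircleMoment_add_two (α : ℝ) (n : ℕ) :
    semicircleMoment α (n + 2) = ∑ p ∈ antidiagonal n,
      α * semicircleMoment α p.1 * semicircleMoment α p.2 := by
  rcases Nat.even_or_odd n with ⟨m, rfl⟩ | hn
  · rw [show m + m + 2 = 2 * (m + 1) by ring, semicircleMoment_two_mul, catalan_succ',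
      Nat.cast_sum, Finset.mul_sum]
    refine Finset.sum_of_injOn (fun p : ℕ × ℕ => (2 * p.1, 2 * p.2)) ?_ ?_ ?_ ?_
    · rintro ⟨a, b⟩ _ ⟨c, d⟩ _ h
      simp only [Prod.mk.injEq] at h ⊢
      omega
    · rintro ⟨a, b⟩ h
      simp only [Finset.mem_coe, mem_antidiagonal] at h ⊢
      omega
    · rintro ⟨a, b⟩ h h'
      rw [mem_antidiagonal] at h
      have ha : Odd a := by
        rw [← Nat.not_even_iff_odd]
        rintro ⟨c, rfl⟩
        refine h' ⟨(c, m - c), ?_, ?_⟩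
        · simp only [Finset.mem_coe, mem_antidiagonal]
          dsimp only at h
          omega
        · dsimp only at h ⊢
          ext <;> dsimp only <;> omega
      simp [semicircleMoment_of_odd α ha]
    · rintro ⟨a, b⟩ h
      rw [mem_antidiagonal] at h
      simp only [semicircleMoment_two_mul, ← h]
      push_cast
      ring
  · rw [semicircleMoment_of_odd α (by simpa [parity_simps] using hn), eq_comm]
    refine Finset.sum_eq_zero fun p hp => ?_
    rw [mem_antidiagonal] at hp
    rcases Nat.even_or_odd p.1 with h | h
    · have : Odd p.2 := by
        rw [← hp] at hn
        exact (Nat.odd_add'.1 hn).2 h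
      simp [semicircleMoment_of_odd α this]
    · simp [semicircleMoment_of_odd α h]

section Deletion

variable {V : Type*} [DecidableEq V]

/-- The matrix obtained by replacing the row and the column of `x` with zeros. -/
def zeroOut {R : Type*} [Zero R] (A : Matrix V V R) (x : V) : Matrix V V R :=
  Matrix.of fun y z => if y = x ∨ z = x then 0 else A y z

variable [Fintype V]

theorem zeroOut_pow_succ_apply_right {R : Type*} [CommRing R] (A : Matrix V V R) (x y : V)
    (n : ℕ) : (zeroOut A x ^ (n + 1)) y x = 0 := by
  simp [pow_succ, Matrix.mul_apply, zeroOut]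

theorem pow_succ_apply_of_ne {R : Type*} [CommRing R] (A : Matrix V V R) (x w : V) (n : ℕ) :
    ∀ y, y ≠ x → (A ^ (n + 1)) y w = (zeroOut A x ^ (n + 1)) y w +
      ∑ p ∈ antidiagonal n, (zeroOut A x ^ p.1 * A) y x * (A ^ p.2) x w := by
  have split : ∀ y, y ≠ x → ∀ f : V → R,
      ∑ u, A y u * f u = A y x * f x + ∑ u, zeroOut A x y u * f u := by
    intro y hy f
    rw [← Finset.add_sum_erase _ _ (Finset.mem_univ x),
      ← Finset.add_sum_erase _ (fun u => zeroOut A x y u * f u) (Finset.mem_univ x)]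
    have : zeroOut A x y x = 0 := by simp [zeroOut]
    rw [this, zero_mul, zero_add]
    congr 1
    refine Finset.sum_congr rfl fun u hu => ?_
    simp [zeroOut, hy, Finset.ne_of_mem_erase hu]
  induction n with
  | zero =>
    intro y hy
    have := split y hy (fun u => (1 : Matrix V V R) u w)
    simp only [← Matrix.mul_apply, mul_one] at this
    simp [this, add_comm]
  | succ n ih =>
    intro y hy
    rw [pow_succ' A, Matrix.mul_apply, split y hy, Finset.Nat.sum_antidiagonal_succ]
    have : ∀ u, zeroOut A x y u * (A ^ (n + 1)) u w = zeroOut A x y u *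
        ((zeroOut A x ^ (n + 1)) u w +
          ∑ p ∈ antidiagonal n, (zeroOut A x ^ p.1 * A) u x * (A ^ p.2) x w) := by
      intro u
      by_cases hu : u = x
      · simp [zeroOut, hu]
      · rw [ih u hu]
    simp only [this, mul_add, Finset.sum_add_distrib, ← Matrix.mul_apply, ← pow_succ',
      Finset.mul_sum]
    rw [Finset.sum_comm]
    have shift : ∀ p : ℕ × ℕ,
        ∑ u, zeroOut A x y u * ((zeroOut A x ^ p.1 * A) u x * (A ^ p.2) x w) =
          (zeroOut A x ^ (p.1 + 1) * A) y x * (A ^ p.2) x w := fun p => by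
      simp only [← mul_assoc, ← Finset.sum_mul, ← Matrix.mul_apply, pow_succ']
    simp only [shift, pow_zero, one_mul]
    ring

theorem pow_add_two_apply_self {R : Type*} [CommRing R] (A : Matrix V V R) (x : V)
    (hx : A x x = 0) (n : ℕ) :
    (A ^ (n + 2)) x x = ∑ p ∈ antidiagonal n,
      (∑ y, A x y * (zeroOut A x ^ p.1 * A) y x) * (A ^ p.2) x x := by
  rw [pow_succ' A, Matrix.mul_apply]
  simp only [Finset.sum_mul]
  rw [Finset.sum_comm]
  refine Finset.sum_congr rfl fun y _ => ?_
  by_cases hy : y = x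
  · simp [hy, hx]
  · rw [pow_succ_apply_of_ne A x x n y hy, zeroOut_pow_succ_apply_right, zero_add,
      Finset.mul_sum]
    simp only [mul_assoc]

theorem zeroOut_pow_apply_nonneg {A : Matrix V V ℝ} (hA : ∀ y z, 0 ≤ A y z) (x : V) (n : ℕ) :
    ∀ y z, 0 ≤ (zeroOut A x ^ n) y z := by
  have h : ∀ y z, 0 ≤ zeroOut A x y z := fun y z => by
    simp only [zeroOut, Matrix.of_apply]
    split_ifs
    exacts [le_rfl, hA y z]
  induction n with
  | zero => intro y z; rw [pow_zero, Matrix.one_apply]; split_ifs <;> norm_num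
  | succ n ih =>
    intro y z
    rw [pow_succ, Matrix.mul_apply]
    exact Finset.sum_nonneg fun u _ => mul_nonneg (ih y u) (h u z)

theorem zeroOut_pow_apply_le {A : Matrix V V ℝ} (hA : ∀ y z, 0 ≤ A y z) (x : V) (n : ℕ) :
    ∀ y z, (zeroOut A x ^ n) y z ≤ (A ^ n) y z := by
  induction n with
  | zero => simp
  | succ n ih =>
    intro y z
    rw [pow_succ, pow_succ, Matrix.mul_apply, Matrix.mul_apply]
    refine Finset.sum_le_sum fun u _ => ?_
    simp only [zeroOut, Matrix.of_apply]
    have h₀ := (zeroOut_pow_apply_nonneg hA x n y u).trans (ih y u)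
    split_ifs
    · simpa using mul_nonneg h₀ (hA u z)
    · exact mul_le_mul_of_nonneg_right (ih y u) (hA u z)

end Deletion

section AdjMat

variable {V : Type*} (G : SimpleGraph V)

theorem adjMat_nonneg (x y : V) : 0 ≤ adjMat G x y := by
  simp only [adjMat, Matrix.of_apply]
  split_ifs <;> norm_num

theorem adjMat_comm (x y : V) : adjMat G x y = adjMat G y x := by
  classical
  exact if_congr (G.adj_comm x y) rfl rfl

theorem adjMat_self (x : V) : adjMat G x x = 0 := by
  simp [adjMat]

variable {G} in
theorem adjMat_of_adj {x y : V} (h : G.Adj x y) : adjMat G x y = 1 := by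
  simp [adjMat, h]

variable {G} in
theorem adjMat_of_not_adj {x y : V} (h : ¬ G.Adj x y) : adjMat G x y = 0 := by
  simp [adjMat, h]

theorem sum_adjMat [Fintype V] (x : V) : ∑ y, adjMat G x y = vdegree G x := by
  classical
  simp [adjMat, vdegree, Finset.sum_boole, Nat.card_eq_fintype_card]

/-- The graph has no cycle of length `k` for `3 ≤ k ≤ K`. -/
def NoShortCycle (K : ℕ) : Prop :=
  ∀ k, 3 ≤ k → k ≤ K → injCount (SimpleGraph.cycleGraph k) G = 0

variable {G} in
theorem NoShortCycle.mono {K L : ℕ} (h : NoShortCycle G K) (hL : L ≤ K) : NoShortCycle G L :=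
  fun k h₃ hk => h k h₃ (hk.trans hL)

variable {G} in
theorem NoShortCycle.lt_length [Finite V] {K : ℕ} (h : NoShortCycle G K) {x : V}
    {p : G.Walk x x} (hp : p.IsCycle) : K < p.length := by
  by_contra! hK
  have hc : (SimpleGraph.cycleGraph p.length).IsContained G :=
    (SimpleGraph.cycleGraph_isContained_iff hp.three_le_length).2 ⟨x, p, hp, rfl⟩
  obtain ⟨f⟩ := hc
  have : Finite {f : SimpleGraph.cycleGraph p.length →g G // Function.Injective f} := inferInstance
  have h0 := h _ hp.three_le_length hK
  rw [injCount, Finite.card_eq_zero_iff] at h0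
  exact h0.elim ⟨f.toHom, f.injective⟩

variable [Fintype V] [DecidableEq V]

variable {G} in
theorem exists_walk_of_zeroOut_pow_ne_zero {x z : V} (n : ℕ) :
    ∀ {y}, y ≠ x → (zeroOut (adjMat G) x ^ n) y z ≠ 0 →
      ∃ p : G.Walk y z, p.length = n ∧ x ∉ p.support := by
  induction n with
  | zero =>
    intro y hy h
    obtain rfl : y = z := by
      by_contra hyz
      simp [hyz] at h
    exact ⟨.nil, rfl, by simpa using hy.symm⟩
  | succ n ih =>
    intro y hy h
    rw [pow_succ', Matrix.mul_apply] at h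
    obtain ⟨u, -, hu⟩ := Finset.exists_ne_zero_of_sum_ne_zero h
    have hyu := left_ne_zero_of_mul hu
    have hux : u ≠ x := fun hux => hyu (by simp [zeroOut, hux])
    have hadj : G.Adj y u := by
      by_contra hadj
      exact hyu (by simp [zeroOut, adjMat_of_not_adj hadj])
    obtain ⟨p, hp, hxp⟩ := ih hux (right_ne_zero_of_mul hu)
    exact ⟨.cons hadj p, by simp [hp], by simp [hxp, hy.symm]⟩

variable {G}

theorem zeroOut_pow_apply_eq_zero {K i : ℕ} (h : NoShortCycle G K) (hi : i + 2 ≤ K) {x y z : V}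
    (hy : G.Adj x y) (hz : G.Adj x z) (hyz : y ≠ z) : (zeroOut (adjMat G) x ^ i) y z = 0 := by
  by_contra h0
  obtain ⟨p, hp, hx⟩ := exists_walk_of_zeroOut_pow_ne_zero i hy.ne' h0
  have hxb : x ∉ p.bypass.support := fun hxb => hx (p.support_bypass_subset_support hxb)
  have hcyc : (SimpleGraph.Walk.cons hy (p.bypass.concat hz.symm)).IsCycle := by
    rw [SimpleGraph.Walk.cons_isCycle_iff]
    refine ⟨p.bypass_isPath.concat hxb hz.symm, ?_⟩
    rw [SimpleGraph.Walk.edges_concat, List.concat_eq_append, List.mem_append, not_or]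
    refine ⟨fun he => hxb (SimpleGraph.Walk.fst_mem_support_of_mem_edges _ he), ?_⟩
    simp only [List.mem_singleton, Sym2.eq_iff]
    rintro (⟨h, -⟩ | ⟨-, h⟩)
    exacts [hz.ne h, hyz h]
  have hlt := h.lt_length hcyc
  rw [SimpleGraph.Walk.length_cons, SimpleGraph.Walk.length_concat] at hlt
  have := p.length_bypass_le_length
  omega

theorem zeroOut_pow_mul_adjMat_apply {K i : ℕ} (h : NoShortCycle G K) (hi : i + 2 ≤ K)
    {x y : V} (hy : G.Adj x y) :
    (zeroOut (adjMat G) x ^ i * adjMat G) y x = (zeroOut (adjMat G) x ^ i) y y := by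
  rw [Matrix.mul_apply, Finset.sum_eq_single y]
  · rw [adjMat_of_adj hy.symm, mul_one]
  · intro z _ hz
    by_cases hxz : G.Adj x z
    · rw [zeroOut_pow_apply_eq_zero h hi hy hxz hz.symm, zero_mul]
    · rw [adjMat_of_not_adj (fun hzx => hxz hzx.symm), mul_zero]
  · simp

/-- First-return decomposition of closed walks in a graph without short cycles. -/
theorem adjMat_pow_add_two_apply_self {n : ℕ} (h : NoShortCycle G (n + 2)) (x : V) :
    (adjMat G ^ (n + 2)) x x = ∑ p ∈ antidiagonal n,
      (∑ y, adjMat G x y * (zeroOut (adjMat G) x ^ p.1) y y) * (adjMat G ^ p.2) x x := by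
  rw [pow_add_two_apply_self _ _ (adjMat_self G x)]
  refine Finset.sum_congr rfl fun p hp => ?_
  rw [mem_antidiagonal] at hp
  congr 1
  refine Finset.sum_congr rfl fun y _ => ?_
  by_cases hy : G.Adj x y
  · rw [zeroOut_pow_mul_adjMat_apply h (by omega) hy]
  · simp [adjMat_of_not_adj hy]

theorem adjMat_pow_succ_apply_self_of_adj {n : ℕ} (h : NoShortCycle G (n + 2)) {x y : V}
    (hy : G.Adj x y) :
    (adjMat G ^ (n + 1)) y y = (zeroOut (adjMat G) x ^ (n + 1)) y y +
      ∑ p ∈ antidiagonal n, (zeroOut (adjMat G) x ^ p.1) y y * (adjMat G ^ p.2) x y := by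
  rw [pow_succ_apply_of_ne _ x y n y hy.ne']
  congr 1
  refine Finset.sum_congr rfl fun p hp => ?_
  rw [mem_antidiagonal] at hp
  rw [zeroOut_pow_mul_adjMat_apply h (by omega) hy]

theorem adjMat_pow_comm (n : ℕ) (x y : V) : (adjMat G ^ n) x y = (adjMat G ^ n) y x := by
  have h : (adjMat G).IsSymm := Matrix.IsSymm.ext fun i j => adjMat_comm G j i
  exact ((h.pow n).apply x y).symm

theorem adjMat_pow_apply_nonneg (n : ℕ) (x y : V) : 0 ≤ (adjMat G ^ n) x y :=
  (zeroOut_pow_apply_nonneg (adjMat_nonneg G) x n x y).trans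
    (zeroOut_pow_apply_le (adjMat_nonneg G) x n x y)

theorem sum_adjMat_mul_pow (n : ℕ) (x : V) :
    ∑ y, adjMat G x y * (adjMat G ^ n) x y = (adjMat G ^ (n + 1)) x x := by
  rw [pow_succ', Matrix.mul_apply]
  exact Finset.sum_congr rfl fun y _ => by rw [adjMat_pow_comm]

theorem adjMat_pow_apply_self_le {s : ℝ} (hs : 0 ≤ s)
    (hdeg : ∀ x, (vdegree G x : ℝ) ≤ s ^ 2) (k : ℕ) (h : NoShortCycle G k) (x : V) :
    (adjMat G ^ k) x x ≤ semicircleMoment 1 k * s ^ k := by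
  induction k using Nat.strong_induction_on generalizing x with
  | _ k ih =>
    match k with
    | 0 => simp [semicircleMoment_zero]
    | 1 => simp [semicircleMoment_one, adjMat_self]
    | n + 2 =>
      rw [adjMat_pow_add_two_apply_self h, semicircleMoment_add_two, Finset.sum_mul]
      refine Finset.sum_le_sum fun p hp => ?_
      rw [mem_antidiagonal] at hp
      have h1 := ih p.1 (by omega) (h.mono (by omega))
      have h2 := ih p.2 (by omega) (h.mono (by omega)) x
      have hc := semicircleMoment_nonneg zero_le_one p.1
      calc (∑ y, adjMat G x y * (zeroOut (adjMat G) x ^ p.1) y y) * (adjMat G ^ p.2) x x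
          ≤ (∑ y, adjMat G x y * (semicircleMoment 1 p.1 * s ^ p.1)) *
              (semicircleMoment 1 p.2 * s ^ p.2) := by
            refine mul_le_mul (Finset.sum_le_sum fun y _ => mul_le_mul_of_nonneg_left
              ((zeroOut_pow_apply_le (adjMat_nonneg G) x _ y y).trans (h1 y))
              (adjMat_nonneg G x y)) h2 (adjMat_pow_apply_nonneg _ x x) ?_
            exact Finset.sum_nonneg fun y _ => mul_nonneg (adjMat_nonneg G x y) (by positivity)
        _ ≤ (s ^ 2 * (semicircleMoment 1 p.1 * s ^ p.1)) *
              (semicircleMoment 1 p.2 * s ^ p.2) := by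
            have hc2 := semicircleMoment_nonneg zero_le_one p.2
            rw [← Finset.sum_mul, sum_adjMat]
            gcongr
            exact hdeg x
        _ = 1 * semicircleMoment 1 p.1 * semicircleMoment 1 p.2 * s ^ (n + 2) := by
            rw [← hp]
            ring

/-- Forbidding the closed walks at the neighbours of `x` from visiting `x` loses only a
lower-order term. -/
theorem sum_adjMat_mul_pow_sub_zeroOut_le {s : ℝ} (hs : 0 ≤ s)
    (hdeg : ∀ x, (vdegree G x : ℝ) ≤ s ^ 2) (n : ℕ) (h : NoShortCycle G (n + 2)) (x : V) :
    ∑ y, adjMat G x y * ((adjMat G ^ (n + 1)) y y - (zeroOut (adjMat G) x ^ (n + 1)) y y) ≤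
      (∑ p ∈ antidiagonal n, semicircleMoment 1 p.1 * semicircleMoment 1 (p.2 + 1)) *
        s ^ (n + 1) := by
  have hexp : ∀ y, adjMat G x y *
      ((adjMat G ^ (n + 1)) y y - (zeroOut (adjMat G) x ^ (n + 1)) y y) =
      ∑ p ∈ antidiagonal n,
        (zeroOut (adjMat G) x ^ p.1) y y * (adjMat G x y * (adjMat G ^ p.2) x y) := by
    intro y
    by_cases hy : G.Adj x y
    · rw [adjMat_pow_succ_apply_self_of_adj h hy]
      simp [adjMat_of_adj hy]
    · simp [adjMat_of_not_adj hy]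
  simp only [hexp]
  rw [Finset.sum_comm, Finset.sum_mul]
  refine Finset.sum_le_sum fun p hp => ?_
  rw [mem_antidiagonal] at hp
  have hc := semicircleMoment_nonneg zero_le_one p.1
  calc ∑ y, (zeroOut (adjMat G) x ^ p.1) y y * (adjMat G x y * (adjMat G ^ p.2) x y)
      ≤ ∑ y, semicircleMoment 1 p.1 * s ^ p.1 * (adjMat G x y * (adjMat G ^ p.2) x y) := by
        refine Finset.sum_le_sum fun y _ => mul_le_mul_of_nonneg_right
          ((zeroOut_pow_apply_le (adjMat_nonneg G) x _ y y).trans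
            (adjMat_pow_apply_self_le hs hdeg _ (h.mono (by omega)) y))
          (mul_nonneg (adjMat_nonneg G x y) (adjMat_pow_apply_nonneg _ x y))
    _ = semicircleMoment 1 p.1 * s ^ p.1 * (adjMat G ^ (p.2 + 1)) x x := by
        rw [← Finset.mul_sum, sum_adjMat_mul_pow]
    _ ≤ semicircleMoment 1 p.1 * s ^ p.1 * (semicircleMoment 1 (p.2 + 1) * s ^ (p.2 + 1)) := by
        gcongr
        exact adjMat_pow_apply_self_le hs hdeg _ (h.mono (by omega)) x
    _ = semicircleMoment 1 p.1 * semicircleMoment 1 (p.2 + 1) * s ^ (n + 1) := by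
        rw [← hp]
        ring

end AdjMat

theorem eventually_noShortCycle {V : ℕ → Type*} {G : ∀ n, SimpleGraph (V n)}
    (hgirth : ∀ k : ℕ, 3 ≤ k → ∃ n₀ : ℕ, ∀ n ≥ n₀,
      injCount (SimpleGraph.cycleGraph k) (G n) = 0) (K : ℕ) :
    ∀ᶠ n in atTop, NoShortCycle (G n) K := by
  have : ∀ k ∈ Finset.Icc 3 K, ∀ᶠ n in atTop, injCount (SimpleGraph.cycleGraph k) (G n) = 0 :=
    fun k hk => eventually_atTop.2 (hgirth k (Finset.mem_Icc.1 hk).1)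
  filter_upwards [(Finset.eventually_all (Finset.Icc 3 K)).2 this] with n hn k h3 hk
  exact hn k (Finset.mem_Icc.2 ⟨h3, hk⟩)

section Mean

variable {V : ℕ → Type} [∀ n, Fintype (V n)]

/-- The functions `f n` converge to the constant `c` in normalized `L¹` norm. -/
def TendstoInMean (f : ∀ n, V n → ℝ) (c : ℝ) : Prop :=
  Tendsto (fun n => (∑ x, |f n x - c|) / (Nat.card (V n) : ℝ)) atTop (𝓝 0)

theorem sum_div_card_le_of_forall_le {W : Type*} [Fintype W] {f : W → ℝ} {a : ℝ} (ha : 0 ≤ a)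
    (h : ∀ x, f x ≤ a) : (∑ x, f x) / (Nat.card W : ℝ) ≤ a := by
  refine div_le_of_le_mul₀ (Nat.cast_nonneg _) ha ?_
  calc ∑ x, f x ≤ ∑ _x : W, a := Finset.sum_le_sum fun x _ => h x
    _ = a * Nat.card W := by simp [mul_comm]

namespace TendstoInMean

variable {f g : ∀ n, V n → ℝ} {a b : ℝ}

theorem of_eventually_le {e : ℕ → ℝ} (he : Tendsto e atTop (𝓝 0))
    (h : ∀ᶠ n in atTop, (∑ x, |f n x - a|) / (Nat.card (V n) : ℝ) ≤ e n) :
    TendstoInMean f a :=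
  squeeze_zero' (Eventually.of_forall fun _ => by positivity) h he

theorem of_eventually_abs_sub_le {e : ℕ → ℝ} (hf : TendstoInMean f a)
    (he : Tendsto e atTop (𝓝 0)) (h : ∀ᶠ n in atTop, ∀ x, |g n x - f n x| ≤ e n) :
    TendstoInMean g a := by
  refine of_eventually_le (e := fun n =>
    |e n| + (∑ x, |f n x - a|) / (Nat.card (V n) : ℝ)) (by simpa using he.abs.add hf) ?_
  filter_upwards [h] with n hn
  calc (∑ x, |g n x - a|) / (Nat.card (V n) : ℝ)
      ≤ (∑ x, (|g n x - f n x| + |f n x - a|)) / (Nat.card (V n) : ℝ) := by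
        gcongr with x
        exact abs_sub_le _ _ _
    _ = (∑ x, |g n x - f n x|) / (Nat.card (V n) : ℝ) +
          (∑ x, |f n x - a|) / (Nat.card (V n) : ℝ) := by
        rw [Finset.sum_add_distrib, add_div]
    _ ≤ _ := by
        gcongr
        exact sum_div_card_le_of_forall_le (abs_nonneg _) fun x => (hn x).trans (le_abs_self _)

theorem congr' (hf : TendstoInMean f a) (h : ∀ᶠ n in atTop, ∀ x, g n x = f n x) :
    TendstoInMean g a :=
  hf.of_eventually_abs_sub_le tendsto_const_nhds <| h.mono fun n hn x => by simp [hn x]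

theorem const (c : ℝ) : TendstoInMean (fun n (_ : V n) => c) c := by
  simp [TendstoInMean]

theorem add (hf : TendstoInMean f a) (hg : TendstoInMean g b) :
    TendstoInMean (fun n x => f n x + g n x) (a + b) := by
  have h := Tendsto.add hf hg
  rw [add_zero] at h
  refine of_eventually_le h (Eventually.of_forall fun n => ?_)
  rw [← add_div, ← Finset.sum_add_distrib]
  gcongr with x
  rw [add_sub_add_comm]
  exact abs_add_le _ _

theorem sum {ι : Type*} (s : Finset ι) {F : ι → ∀ n, V n → ℝ} {c : ι → ℝ}
    (h : ∀ i ∈ s, TendstoInMean (F i) (c i)) :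
    TendstoInMean (fun n x => ∑ i ∈ s, F i n x) (∑ i ∈ s, c i) := by
  classical
  induction s using Finset.induction_on with
  | empty => simpa using const 0
  | insert i s hi ih =>
    simp only [Finset.sum_insert hi]
    exact (h i (by simp)).add (ih fun j hj => h j (by simp [hj]))

theorem mul (hf : TendstoInMean f a) (hg : TendstoInMean g b) {C : ℝ}
    (hC : ∀ᶠ n in atTop, ∀ x, |g n x| ≤ C) :
    TendstoInMean (fun n x => f n x * g n x) (a * b) := by
  have h := (Tendsto.const_mul C hf).add (Tendsto.const_mul |a| hg)
  rw [mul_zero, mul_zero, add_zero] at h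
  refine of_eventually_le h ?_
  filter_upwards [hC] with n hn
  rw [← mul_div_assoc, ← mul_div_assoc, ← add_div, Finset.mul_sum, Finset.mul_sum,
    ← Finset.sum_add_distrib]
  gcongr with x
  calc |f n x * g n x - a * b| = |g n x * (f n x - a) + a * (g n x - b)| := by ring_nf
    _ ≤ |g n x * (f n x - a)| + |a * (g n x - b)| := abs_add_le _ _
    _ ≤ C * |f n x - a| + |a| * |g n x - b| := by
      rw [abs_mul, abs_mul]
      gcongr
      exact hn x

theorem tendsto_sum_div_card [∀ n, Nonempty (V n)] (hf : TendstoInMean f a) :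
    Tendsto (fun n => (∑ x, f n x) / (Nat.card (V n) : ℝ)) atTop (𝓝 a) := by
  rw [tendsto_iff_norm_sub_tendsto_zero]
  refine squeeze_zero (fun _ => norm_nonneg _) (fun n => ?_) hf
  have hpos : (0 : ℝ) < Nat.card (V n) := by exact_mod_cast Nat.card_pos
  have : (∑ x, f n x) / (Nat.card (V n) : ℝ) - a =
      (∑ x, (f n x - a)) / (Nat.card (V n) : ℝ) := by
    rw [Finset.sum_sub_distrib, sub_div]
    simp [Nat.card_eq_fintype_card]
  rw [this, Real.norm_eq_abs, abs_div, abs_of_pos hpos]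
  gcongr
  exact Finset.abs_sum_le_sum_abs _ _

end TendstoInMean

variable {G : ∀ n, SimpleGraph (V n)} {d : ℕ → ℝ} {α : ℝ}

theorem AlphaRegular.tendstoInMean_vdegree (hα0 : 0 ≤ α) (hα1 : α ≤ 1)
    (hadm : ∀ n, Admissible (G n) (d n)) (hreg : AlphaRegular V G d α) :
    TendstoInMean (fun n x => (vdegree (G n) x : ℝ) / d n) α := by
  classical
  have hbound : ∀ ε : ℝ, 0 < ε → ∀ n,
      (∑ x, |(vdegree (G n) x : ℝ) / d n - α|) / (Nat.card (V n) : ℝ) ≤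
        ε + (Nat.card {x : V n // ε ≤ |(vdegree (G n) x : ℝ) / d n - α|} : ℝ) /
          (Nat.card (V n) : ℝ) := by
    intro ε hε n
    have hcard : (Nat.card {x : V n // ε ≤ |(vdegree (G n) x : ℝ) / d n - α|} : ℝ) =
        ∑ x, if ε ≤ |(vdegree (G n) x : ℝ) / d n - α| then (1 : ℝ) else 0 := by
      rw [Finset.sum_boole, Nat.card_eq_fintype_card, Fintype.card_subtype]
    rw [hcard, ← sub_le_iff_le_add, ← sub_div, ← Finset.sum_sub_distrib]
    refine sum_div_card_le_of_forall_le hε.le fun x => ?_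
    obtain ⟨hd, hdeg⟩ := hadm n
    have h0 : 0 ≤ (vdegree (G n) x : ℝ) / d n := by positivity
    have h1 : (vdegree (G n) x : ℝ) / d n ≤ 1 := div_le_one_of_le₀ (hdeg x) (by linarith)
    split_ifs with h
    · have : |(vdegree (G n) x : ℝ) / d n - α| ≤ 1 := abs_le.2 ⟨by linarith, by linarith⟩
      linarith
    · linarith
  rw [TendstoInMean, Metric.tendsto_atTop]
  intro ε hε
  obtain ⟨N, hN⟩ := Metric.tendsto_atTop.1 (hreg (ε / 2) (half_pos hε)) (ε / 2) (half_pos hε)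
  refine ⟨N, fun n hn => ?_⟩
  have h1 := hbound (ε / 2) (half_pos hε) n
  have h2 := hN n hn
  rw [Real.dist_eq, sub_zero] at h2 ⊢
  rw [abs_of_nonneg (by positivity)]
  linarith [le_abs_self ((Nat.card {x : V n // ε / 2 ≤ |(vdegree (G n) x : ℝ) / d n - α|} : ℝ) /
          (Nat.card (V n) : ℝ))]

theorem TendstoInMean.sum_adjMat_mul_div {f : ∀ n, V n → ℝ} {c : ℝ} (hf : TendstoInMean f c)
    (hadm : ∀ n, Admissible (G n) (d n))
    (hdeg : TendstoInMean (fun n x => (vdegree (G n) x : ℝ) / d n) α) :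
    TendstoInMean (fun n x => (∑ y, adjMat (G n) x y * f n y) / d n) (α * c) := by
  have h := Tendsto.add hf (Tendsto.const_mul |c| hdeg)
  rw [mul_zero, add_zero] at h
  refine of_eventually_le h (Eventually.of_forall fun n => ?_)
  obtain ⟨hd, hle⟩ := hadm n
  have hd0 : 0 < d n := by linarith
  rw [← mul_div_assoc, ← add_div, Finset.mul_sum]
  gcongr
  calc ∑ x, |(∑ y, adjMat (G n) x y * f n y) / d n - α * c|
      ≤ ∑ x, ((∑ y, adjMat (G n) x y * |f n y - c|) / d n +
          |c| * |(vdegree (G n) x : ℝ) / d n - α|) := by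
        gcongr with x
        have : (∑ y, adjMat (G n) x y * f n y) / d n - α * c =
            (∑ y, adjMat (G n) x y * (f n y - c)) / d n +
              c * ((vdegree (G n) x : ℝ) / d n - α) := by
          simp only [mul_sub, Finset.sum_sub_distrib, ← Finset.sum_mul, sum_adjMat]
          ring
        rw [this]
        refine (abs_add_le _ _).trans ?_
        rw [abs_mul, abs_div, abs_of_pos hd0]
        gcongr
        refine (Finset.abs_sum_le_sum_abs _ _).trans (le_of_eq ?_)
        exact Finset.sum_congr rfl fun y _ => by rw [abs_mul, abs_of_nonneg (adjMat_nonneg _ x y)]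
    _ = (∑ y, (vdegree (G n) y : ℝ) / d n * |f n y - c|) +
          ∑ x, |c| * |(vdegree (G n) x : ℝ) / d n - α| := by
        rw [Finset.sum_add_distrib, ← Finset.sum_div, Finset.sum_comm, Finset.sum_div]
        congr 1
        refine Finset.sum_congr rfl fun y _ => ?_
        rw [← Finset.sum_mul, Finset.sum_congr rfl fun x _ => adjMat_comm (G n) x y, sum_adjMat]
        ring
    _ ≤ (∑ y, |f n y - c|) + ∑ x, |c| * |(vdegree (G n) x : ℝ) / d n - α| := by
        gcongr with y
        exact mul_le_of_le_one_left (abs_nonneg _) (div_le_one_of_le₀ (hle y) hd0.le)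

variable [∀ n, DecidableEq (V n)]

/-- The return counts `(A ^ k) x x`, normalized by `d ^ (k / 2)`, converge in mean to the moments
of a semicircle law. -/
theorem tendstoInMean_adjMat_pow (hadm : ∀ n, Admissible (G n) (d n))
    (hdtop : Tendsto d atTop atTop)
    (hdeg : TendstoInMean (fun n x => (vdegree (G n) x : ℝ) / d n) α)
    (hcyc : ∀ K, ∀ᶠ n in atTop, NoShortCycle (G n) K) (k : ℕ) :
    TendstoInMean (fun n x => (adjMat (G n) ^ k) x x / √(d n) ^ k) (semicircleMoment α k) := by
  have hspos : ∀ n, 0 < √(d n) := fun n => Real.sqrt_pos.2 (by linarith [(hadm n).1])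
  have hsq : ∀ n, √(d n) ^ 2 = d n := fun n => Real.sq_sqrt (by linarith [(hadm n).1])
  have hle : ∀ n x, (vdegree (G n) x : ℝ) ≤ √(d n) ^ 2 := fun n x => by
    rw [hsq]
    exact (hadm n).2 x
  have hbdd : ∀ j, ∀ᶠ n in atTop, ∀ x,
      |(adjMat (G n) ^ j) x x / √(d n) ^ j| ≤ semicircleMoment 1 j := by
    intro j
    filter_upwards [hcyc j] with n hn x
    rw [abs_of_nonneg (div_nonneg (adjMat_pow_apply_nonneg _ _ _) (by positivity)),
      div_le_iff₀ (pow_pos (hspos n) _)]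
    exact adjMat_pow_apply_self_le (hspos n).le (hle n) j hn x
  have hdel : ∀ i, TendstoInMean (fun n x => (adjMat (G n) ^ i) x x / √(d n) ^ i)
      (semicircleMoment α i) → TendstoInMean (fun n x =>
        (∑ y, adjMat (G n) x y * (zeroOut (adjMat (G n)) x ^ i) y y) / √(d n) ^ (i + 2))
        (α * semicircleMoment α i) := by
    intro i hi
    have hrw : ∀ n (x : V n), ∀ f : V n → ℝ, (∑ y, adjMat (G n) x y * f y) / √(d n) ^ (i + 2) =
        (∑ y, adjMat (G n) x y * (f y / √(d n) ^ i)) / d n := by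
      intro n x f
      simp only [← mul_div_assoc, ← Finset.sum_div]
      rw [div_div, pow_add, hsq]
    have hmain := hi.sum_adjMat_mul_div hadm hdeg
    simp only [← hrw] at hmain
    match i with
    | 0 => simpa using hmain
    | i + 1 =>
      refine hmain.of_eventually_abs_sub_le (e := fun n =>
        (∑ p ∈ antidiagonal i, semicircleMoment 1 p.1 * semicircleMoment 1 (p.2 + 1)) / d n)
        (hdtop.const_div_atTop _) ?_
      filter_upwards [hcyc (i + 2)] with n hn x
      have hs := hspos n
      rw [abs_sub_comm, ← sub_div, ← Finset.sum_sub_distrib]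
      simp only [← mul_sub]
      rw [abs_of_nonneg (div_nonneg (Finset.sum_nonneg fun y _ =>
        mul_nonneg (adjMat_nonneg _ _ _) (sub_nonneg.2
          (zeroOut_pow_apply_le (adjMat_nonneg _) _ _ _ _))) (by positivity)),
        div_le_iff₀ (by positivity)]
      refine (sum_adjMat_mul_pow_sub_zeroOut_le hs.le (hle n) i hn x).trans (le_of_eq ?_)
      rw [pow_add _ (i + 1) 2, hsq]
      have := (hadm n).1
      field_simp
  induction k using Nat.strong_induction_on with
  | _ k ih =>
    match k with
    | 0 => simpa [semicircleMoment_zero] using TendstoInMean.const 1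
    | 1 => simpa [semicircleMoment_one, adjMat_self] using TendstoInMean.const 0
    | m + 2 =>
      rw [semicircleMoment_add_two]
      refine (TendstoInMean.sum (antidiagonal m) fun p hp => ?_).congr' (f := fun n x =>
        ∑ p ∈ antidiagonal m,
          (∑ y, adjMat (G n) x y * (zeroOut (adjMat (G n)) x ^ p.1) y y) / √(d n) ^ (p.1 + 2) *
            ((adjMat (G n) ^ p.2) x x / √(d n) ^ p.2)) ?_
      · rw [mem_antidiagonal] at hp
        exact (hdel p.1 (ih p.1 (by omega))).mul (ih p.2 (by omega)) (hbdd p.2)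
      · filter_upwards [hcyc (m + 2)] with n hn x
        rw [adjMat_pow_add_two_apply_self hn, Finset.sum_div]
        refine Finset.sum_congr rfl fun p hp => ?_
        rw [mem_antidiagonal] at hp
        rw [div_mul_div_comm, ← pow_add, ← hp]
        ring_nf

end Mean

/-- If `(Gₙ,dₙ)` is `α`-regular with `dₙ → ∞` and has large girth (for
every `k ≥ 3`, eventually `Gₙ` contains no `k`-cycle), then for every `k ≥ 1` the
normalized number of closed `k`-walks `w_k(Gₙ)/(v(Gₙ)·dₙ^{k/2})` tends to `0` for odd `k`,
and to `α^{k/2}` times the `(k/2)`-th Catalan number for even `k`. -/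
theorem stmt14 (V : ℕ → Type) [∀ n, Fintype (V n)] [∀ n, Nonempty (V n)]
    [∀ n, DecidableEq (V n)]
    (G : ∀ n, SimpleGraph (V n)) (d : ℕ → ℝ) (α : ℝ) (hα0 : 0 ≤ α) (hα1 : α ≤ 1)
    (hadm : ∀ n, Admissible (G n) (d n))
    (hdtop : Tendsto d atTop atTop)
    (hreg : AlphaRegular V G d α)
    (hgirth : ∀ k : ℕ, 3 ≤ k → ∃ n₀ : ℕ, ∀ n ≥ n₀,
      injCount (SimpleGraph.cycleGraph k) (G n) = 0) :
    ∀ k : ℕ, 1 ≤ k →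
      (Odd k →
        Tendsto (fun n => closedWalkCount (G n) k /
            ((Nat.card (V n) : ℝ) * d n ^ ((k : ℝ) / 2)))
          atTop (𝓝 0)) ∧
      (∀ m : ℕ, k = 2 * m →
        Tendsto (fun n => closedWalkCount (G n) k /
            ((Nat.card (V n) : ℝ) * d n ^ ((k : ℝ) / 2)))
          atTop (𝓝 (α ^ m * (catalan m : ℝ)))) := by
  have hdeg := hreg.tendstoInMean_vdegree hα0 hα1 hadm
  have hmain : ∀ k : ℕ, Tendsto (fun n => closedWalkCount (G n) k /
      ((Nat.card (V n) : ℝ) * d n ^ ((k : ℝ) / 2))) atTop (𝓝 (semicircleMoment α k)) := by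
    intro k
    refine (tendstoInMean_adjMat_pow hadm hdtop hdeg
      (eventually_noShortCycle hgirth) k).tendsto_sum_div_card.congr fun n => ?_
    have hd : 0 ≤ d n := by linarith [(hadm n).1]
    have hpow : d n ^ ((k : ℝ) / 2) = √(d n) ^ k := by
      rw [Real.sqrt_eq_rpow, ← Real.rpow_mul_natCast hd]
      ring_nf
    rw [closedWalkCount, hpow, ← Finset.sum_div, div_div, mul_comm, Matrix.trace]
    simp only [Matrix.diag_apply]
  intro k _
  refine ⟨fun hk => ?_, fun m hm => ?_⟩
  · simpa only [semicircleMoment_of_odd α hk] using hmain k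
  · subst hm
    simpa only [semicircleMoment_two_mul] using hmain (2 * m)
end

section
/- Define two subsets of [0,1] by their binary expansions: S_cube = { Σ_{j=1}^∞ a_j 2^{−j} : a_j ∈ {0,1}, with a_1 = a_2, a_3 = a_4, a_5 = a_6 = a_7 = a_8, a_9 = ⋯ = a_16, and in general all digits a_j with 2^{m−1} < j ≤ 2^m equal for each m ≥ 2 }, and S_proj = { Σ_{j=1}^∞ a_j 2^{−j} : a_j ∈ {0,1}, with a_1 = a_2 = a_3 and a_{2m} = a_{2m+1} for every m ≥ 2 }. Let μ_cube be the Hausdorff-type outer measure on ℝ with gauge function h_cube(x) = 1/log_2(1/x), and μ_proj the one with gauge function h_proj(x) = √(2x); here the measure with gauge h assigns to a set B the value lim_{δ→0} inf { Σ_{i=1}^∞ h(diam I_i) : B ⊆ ∪_i I_i, diam I_i < δ for all i }. Then S_cube and S_proj are compact, μ_cube(S_cube) = 1, and μ_proj(S_proj) = 1. -/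
open MeasureTheory

/-- The real number with binary digits `a 1, a 2, …` after the binary point. -/
noncomputable def binExp (a : ℕ → ℕ) : ℝ := ∑' j : ℕ, (a (j + 1) : ℝ) / 2 ^ (j + 1)

/-- `S_cube`: reals `Σ a_j 2^{-j}` with binary digits satisfying `a_1 = a_2` and, for each
`m ≥ 2`, all digits `a_j` with `2^{m-1} < j ≤ 2^m` equal. -/
def Scube : Set ℝ :=
  {x | ∃ a : ℕ → ℕ, (∀ j, a j ≤ 1) ∧ x = binExp a ∧ a 1 = a 2 ∧
    ∀ m : ℕ, 2 ≤ m → ∀ j k : ℕ,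
      2 ^ (m - 1) < j → j ≤ 2 ^ m → 2 ^ (m - 1) < k → k ≤ 2 ^ m → a j = a k}

/-- `S_proj`: reals `Σ a_j 2^{-j}` with binary digits satisfying `a_1 = a_2 = a_3` and
`a_{2m} = a_{2m+1}` for every `m ≥ 2`. -/
def Sproj : Set ℝ :=
  {x | ∃ a : ℕ → ℕ, (∀ j, a j ≤ 1) ∧ x = binExp a ∧ a 1 = a 2 ∧ a 2 = a 3 ∧
    ∀ m : ℕ, 2 ≤ m → a (2 * m) = a (2 * m + 1)}

/-- The gauge function `h_cube(x) = 1 / log₂(1/x) = log 2 / log (1/x)`. -/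
noncomputable def hcube : ENNReal → ENNReal :=
  fun x => ENNReal.ofReal (Real.log 2 / Real.log (1 / x.toReal))

/-- The gauge function `h_proj(x) = √(2x)`. -/
noncomputable def hproj : ENNReal → ENNReal :=
  fun x => ENNReal.ofReal (Real.sqrt (2 * x.toReal))

/-- The Hausdorff-type metric measure on `ℝ` with gauge `h_cube`. -/
noncomputable def mucube : Measure ℝ := Measure.mkMetric hcube

/-- The Hausdorff-type metric measure on `ℝ` with gauge `h_proj`. -/
noncomputable def muproj : Measure ℝ := Measure.mkMetric hproj

open Filter Topology

/-- The sum of the gaps `ℓ i - ℓ (i + 1)` over the indices `i` selected by `b`. -/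
noncomputable def blockSum (ℓ : ℕ → ℝ) (b : ℕ → Bool) : ℝ :=
  ∑' i, ((b i).toNat : ℝ) * (ℓ i - ℓ (i + 1))

section BlockSum

variable {ℓ : ℕ → ℝ}

theorem toNat_cast_le_one (b : Bool) : (b.toNat : ℝ) ≤ 1 := by
  exact_mod_cast Bool.toNat_le b

theorem hasSum_gap (hℓ : Antitone ℓ) (h0 : Tendsto ℓ atTop (𝓝 0)) (m : ℕ) :
    HasSum (fun i => ℓ (i + m) - ℓ (i + m + 1)) (ℓ m) := by
  rw [hasSum_iff_tendsto_nat_of_nonneg fun i => sub_nonneg.2 (hℓ (Nat.le_succ _))]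
  have h : ∀ n, ∑ i ∈ Finset.range n, (ℓ (i + m) - ℓ (i + m + 1)) = ℓ m - ℓ (n + m) := by
    intro n
    have := Finset.sum_range_sub' (fun i => ℓ (i + m)) n
    simpa [add_right_comm] using this
  simp_rw [h]
  simpa using tendsto_const_nhds.sub ((tendsto_add_atTop_iff_nat m).2 h0)

theorem hasSum_blockSum (hℓ : Antitone ℓ) (h0 : Tendsto ℓ atTop (𝓝 0)) (b : ℕ → Bool) :
    HasSum (fun i => ((b i).toNat : ℝ) * (ℓ i - ℓ (i + 1))) (blockSum ℓ b) := by
  refine (Summable.of_nonneg_of_le (fun i => ?_) (fun i => ?_) (hasSum_gap hℓ h0 0).summable).hasSum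
  · exact mul_nonneg (Nat.cast_nonneg _) (sub_nonneg.2 (hℓ (Nat.le_succ _)))
  · exact mul_le_of_le_one_left (sub_nonneg.2 (hℓ (Nat.le_succ _))) (toNat_cast_le_one _)

theorem continuous_blockSum (hℓ : Antitone ℓ) (h0 : Tendsto ℓ atTop (𝓝 0)) :
    Continuous (blockSum ℓ) := by
  refine continuous_tsum (fun i => ?_) (hasSum_gap hℓ h0 0).summable fun i b => ?_
  · exact ((continuous_of_discreteTopology (f := fun c : Bool => (c.toNat : ℝ))).comp
      (continuous_apply i)).mul continuous_const
  · have h := sub_nonneg.2 (hℓ (Nat.le_succ i))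
    rw [Real.norm_of_nonneg (mul_nonneg (Nat.cast_nonneg _) h)]
    exact mul_le_of_le_one_left h (toNat_cast_le_one _)

theorem isCompact_range_blockSum (hℓ : Antitone ℓ) (h0 : Tendsto ℓ atTop (𝓝 0)) :
    IsCompact (Set.range (blockSum ℓ)) :=
  isCompact_range (continuous_blockSum hℓ h0)

theorem blockSum_mem_Icc (hℓ : Antitone ℓ) (h0 : Tendsto ℓ atTop (𝓝 0)) (b : ℕ → Bool) (n : ℕ) :
    blockSum ℓ b ∈ Set.Icc (∑ i ∈ Finset.range n, ((b i).toNat : ℝ) * (ℓ i - ℓ (i + 1)))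
      (∑ i ∈ Finset.range n, ((b i).toNat : ℝ) * (ℓ i - ℓ (i + 1)) + ℓ n) := by
  have h := (hasSum_nat_add_iff' n).2 (hasSum_blockSum hℓ h0 b)
  have hw : ∀ i, 0 ≤ ℓ i - ℓ (i + 1) := fun i => sub_nonneg.2 (hℓ (Nat.le_succ i))
  have h1 := h.nonneg fun i => mul_nonneg (Nat.cast_nonneg _) (hw _)
  have h2 := hasSum_le (fun i => mul_le_of_le_one_left (hw _) (toNat_cast_le_one _)) h
    (hasSum_gap hℓ h0 n)
  constructor <;> linarith

/-- If `b` and `b'` first differ at `m`, then the tail sum describes how far the difference of the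
block sums falls short of `ℓ m`. -/
theorem hasSum_sub_blockSum_sub (hℓ : Antitone ℓ) (h0 : Tendsto ℓ atTop (𝓝 0)) {b b' : ℕ → Bool}
    {m : ℕ} (hlt : ∀ i < m, b i = b' i) (hb : b m = true) (hb' : b' m = false) :
    HasSum (fun i => (1 + ((b' (i + (m + 1))).toNat : ℝ) - (b (i + (m + 1))).toNat) *
      (ℓ (i + (m + 1)) - ℓ (i + (m + 1) + 1))) (ℓ m - (blockSum ℓ b - blockSum ℓ b')) := by
  have h := (hasSum_nat_add_iff' (m + 1)).2 (hasSum_blockSum hℓ h0 b)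
  have h' := (hasSum_nat_add_iff' (m + 1)).2 (hasSum_blockSum hℓ h0 b')
  have hs : ∑ i ∈ Finset.range m, ((b i).toNat : ℝ) * (ℓ i - ℓ (i + 1)) =
      ∑ i ∈ Finset.range m, ((b' i).toNat : ℝ) * (ℓ i - ℓ (i + 1)) :=
    Finset.sum_congr rfl fun i hi => by rw [hlt i (Finset.mem_range.1 hi)]
  rw [Finset.sum_range_succ] at h h'
  have hd := ((hasSum_gap hℓ h0 (m + 1)).add h').sub h
  rw [hs, hb, hb'] at hd
  refine (congrArg₂ (fun (f : ℕ → ℝ) t => HasSum f t) (funext fun i => ?_) ?_).mpr hd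
  · ring
  · simp only [Bool.toNat_true, Bool.toNat_false]
    push_cast
    ring

theorem sub_blockSum_sub_mem_Icc (hℓ : Antitone ℓ) (h0 : Tendsto ℓ atTop (𝓝 0))
    {b b' : ℕ → Bool} {m : ℕ} (hlt : ∀ i < m, b i = b' i) (hb : b m = true) (hb' : b' m = false) :
    ℓ m - (blockSum ℓ b - blockSum ℓ b') ∈ Set.Icc 0 (2 * ℓ (m + 1)) := by
  have h := hasSum_sub_blockSum_sub hℓ h0 hlt hb hb'
  have hw : ∀ i, 0 ≤ ℓ i - ℓ (i + 1) := fun i => sub_nonneg.2 (hℓ (Nat.le_succ i))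
  have hc := fun i => toNat_cast_le_one (b i)
  have hc' := fun i => toNat_cast_le_one (b' i)
  have hn : ∀ c : Bool, 0 ≤ (c.toNat : ℝ) := fun c => Nat.cast_nonneg _
  refine ⟨h.nonneg fun i => mul_nonneg ?_ (hw _), hasSum_le (fun i => ?_) h
    ((hasSum_gap hℓ h0 (m + 1)).mul_left 2)⟩
  · linarith [hc (i + (m + 1)), hn (b' (i + (m + 1)))]
  · exact mul_le_mul_of_nonneg_right
      (by linarith [hc' (i + (m + 1)), hn (b (i + (m + 1)))]) (hw _)

theorem mul_sub_blockSum_sub_le {ℓ' : ℕ → ℝ} (hℓ : Antitone ℓ) (h0 : Tendsto ℓ atTop (𝓝 0))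
    (hℓ' : Antitone ℓ') (h0' : Tendsto ℓ' atTop (𝓝 0))
    {b b' : ℕ → Bool} {m : ℕ} (hlt : ∀ i < m, b i = b' i) (hb : b m = true) (hb' : b' m = false)
    {A B : ℝ} (hAB : ∀ k, m + 1 ≤ k → A * (ℓ k - ℓ (k + 1)) ≤ B * (ℓ' k - ℓ' (k + 1))) :
    A * (ℓ m - (blockSum ℓ b - blockSum ℓ b')) ≤ B * (ℓ' m - (blockSum ℓ' b - blockSum ℓ' b')) := by
  refine hasSum_le (fun i => ?_) ((hasSum_sub_blockSum_sub hℓ h0 hlt hb hb').mul_left A)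
    ((hasSum_sub_blockSum_sub hℓ' h0' hlt hb hb').mul_left B)
  rw [mul_left_comm, mul_left_comm B]
  refine mul_le_mul_of_nonneg_left (hAB _ (Nat.le_add_left _ _)) ?_
  have := toNat_cast_le_one (b (i + (m + 1)))
  have : (0 : ℝ) ≤ (b' (i + (m + 1))).toNat := Nat.cast_nonneg _
  linarith

theorem mkMetric_range_blockSum_le (hℓ : Antitone ℓ) (h0 : Tendsto ℓ atTop (𝓝 0))
    {h : ENNReal → ENNReal}
    (hh : ∀ n ≠ 0, h (ENNReal.ofReal (ℓ n)) ≤ ENNReal.ofReal ((1 / 2) ^ n)) :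
    Measure.mkMetric h (Set.range (blockSum ℓ)) ≤ 1 := by
  have hdiam : ∀ x n, Metric.ediam (Set.Icc x (x + ℓ n)) = ENNReal.ofReal (ℓ n) := by
    intro x n; rw [Real.ediam_Icc]; simp
  have hr : Tendsto (fun n => ENNReal.ofReal (ℓ n)) atTop (𝓝 0) := by
    simpa using ENNReal.tendsto_ofReal h0
  refine (Measure.mkMetric_le_liminf_sum (ι := fun n => Fin n → Bool) _ _ hr
    (fun n p => Set.Icc (∑ i : Fin n, ((p i).toNat : ℝ) * (ℓ i - ℓ (i + 1)))
      (∑ i : Fin n, ((p i).toNat : ℝ) * (ℓ i - ℓ (i + 1)) + ℓ n)) ?_ ?_ h).trans ?_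
  · exact .of_forall fun n i => (hdiam _ _).le
  · refine .of_forall fun n => ?_
    rintro _ ⟨b, rfl⟩
    refine Set.mem_iUnion.2 ⟨fun i => b i, ?_⟩
    have := blockSum_mem_Icc hℓ h0 b n
    rwa [Finset.sum_range] at this
  · refine liminf_le_of_le (by isBoundedDefault) fun c hc => ?_
    obtain ⟨n, hn, hn0⟩ := (hc.and (eventually_ne_atTop 0)).exists
    refine hn.trans ?_
    simp_rw [hdiam]
    rw [Finset.sum_const, Finset.card_univ, Fintype.card_fun, Fintype.card_bool, Fintype.card_fin,
      nsmul_eq_mul]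
    calc _ ≤ ((2 ^ n : ℕ) : ENNReal) * ENNReal.ofReal ((1 / 2) ^ n) := by gcongr; exact hh n hn0
      _ = ENNReal.ofReal (2 ^ n * (1 / 2) ^ n) := by
        rw [ENNReal.ofReal_mul (by positivity)]
        congr 1
        rw [ENNReal.ofReal_pow (by norm_num)]; simp
      _ = 1 := by rw [← mul_pow]; norm_num

theorem antitone_half_pow : Antitone fun n : ℕ => (1 / 2 : ℝ) ^ n :=
  fun _ _ h => pow_le_pow_of_le_one (by norm_num) (by norm_num) h

theorem tendsto_half_pow : Tendsto (fun n : ℕ => (1 / 2 : ℝ) ^ n) atTop (𝓝 0) :=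
  tendsto_pow_atTop_nhds_zero_of_lt_one (by norm_num) (by norm_num)

theorem Icc_subset_range_blockSum_half :
    Set.Icc 0 1 ⊆ Set.range (blockSum fun n => (1 / 2 : ℝ) ^ n) := by
  intro x hx
  obtain ⟨d, -, rfl⟩ := Real.ofDigits_SurjOn (b := 2) one_lt_two hx
  refine ⟨fun i => d i == 1, tsum_congr fun i => ?_⟩
  have : ((d i == 1).toNat : ℝ) = ((d i : ℕ) : ℝ) := by
    generalize d i = e
    fin_cases e <;> simp
  simp only [this, Real.ofDigitsTerm, pow_succ]
  congr 1
  simp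
  ring

/-- A mass distribution principle: the map sending `blockSum ℓ b` to the number with binary
digits `b` does not increase the size of sets beyond the gauge. -/
theorem one_le_mkMetric_range_blockSum {h : ENNReal → ENNReal} {r : ℝ} (hr : 0 < r)
    (hmono : MonotoneOn h (Set.Iic (ENNReal.ofReal r)))
    (hh : ∀ b b', |blockSum ℓ b - blockSum ℓ b'| ≤ r →
      ENNReal.ofReal |blockSum (fun n => (1 / 2 : ℝ) ^ n) b -
        blockSum (fun n => (1 / 2 : ℝ) ^ n) b'| ≤
      h (ENNReal.ofReal |blockSum ℓ b - blockSum ℓ b'|)) :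
    1 ≤ Measure.mkMetric h (Set.range (blockSum ℓ)) := by
  rw [Measure.mkMetric_apply]
  refine le_iSup₂_of_le (ENNReal.ofReal r) (by simpa using hr) ?_
  refine le_iInf fun t => le_iInf fun hst => le_iInf fun ht => ?_
  set G := blockSum fun n => (1 / 2 : ℝ) ^ n
  have hcov : Set.Icc 0 1 ⊆ ⋃ n, G '' (blockSum ℓ ⁻¹' t n) := by
    refine Icc_subset_range_blockSum_half.trans ?_
    rintro _ ⟨b, rfl⟩
    obtain ⟨n, hn⟩ := Set.mem_iUnion.1 (hst ⟨b, rfl⟩)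
    exact Set.mem_iUnion.2 ⟨n, b, hn, rfl⟩
  calc (1 : ENNReal) = volume (Set.Icc (0 : ℝ) 1) := by simp
    _ ≤ ∑' n, volume (G '' (blockSum ℓ ⁻¹' t n)) := (measure_mono hcov).trans (measure_iUnion_le _)
    _ ≤ _ := ENNReal.tsum_le_tsum fun n => (Real.volume_le_diam _).trans <| Metric.ediam_le ?_
  rintro _ ⟨b, hb, rfl⟩ _ ⟨b', hb', rfl⟩
  refine le_iSup_of_le ⟨_, hb⟩ ?_
  have hd : ENNReal.ofReal |blockSum ℓ b - blockSum ℓ b'| ≤ Metric.ediam (t n) := by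
    rw [← Real.dist_eq, ← edist_dist]
    exact Metric.edist_le_ediam_of_mem hb hb'
  have hd' := hd.trans (ht n)
  rw [edist_dist, Real.dist_eq]
  refine (hh b b' ((ENNReal.ofReal_le_ofReal_iff hr.le).1 hd')).trans (hmono hd' (ht n) hd)

theorem forall_abs_blockSum_sub_of_first_difference {ℓ' : ℕ → ℝ} {h : ENNReal → ENNReal} {r : ℝ}
    (hh : ∀ b b' m, (∀ i < m, b i = b' i) → b m = true → b' m = false →
      |blockSum ℓ b - blockSum ℓ b'| ≤ r →
      ENNReal.ofReal |blockSum ℓ' b - blockSum ℓ' b'| ≤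
        h (ENNReal.ofReal |blockSum ℓ b - blockSum ℓ b'|))
    (b b' : ℕ → Bool) (hr : |blockSum ℓ b - blockSum ℓ b'| ≤ r) :
    ENNReal.ofReal |blockSum ℓ' b - blockSum ℓ' b'| ≤
      h (ENNReal.ofReal |blockSum ℓ b - blockSum ℓ b'|) := by
  by_cases hne : ∃ m, b m ≠ b' m
  · classical
    have hm := Nat.find_spec hne
    have hlt : ∀ i < Nat.find hne, b i = b' i := fun i hi => not_not.1 (Nat.find_min hne hi)
    generalize Nat.find hne = m at hm hlt
    cases hb : b m
    · have hb' : b' m = true := by cases h' : b' m <;> simp_all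
      rw [abs_sub_comm, abs_sub_comm (blockSum ℓ b)]
      exact hh b' b m (fun i hi => (hlt i hi).symm) hb' hb (by rwa [abs_sub_comm])
    · have hb' : b' m = false := by cases h' : b' m <;> simp_all
      exact hh b b' m hlt hb hb' hr
  · push Not at hne
    obtain rfl : b = b' := funext hne
    simp

end BlockSum

section Blocks

variable {N : ℕ → ℕ}

theorem antitone_half_pow_comp (hN : StrictMono N) : Antitone fun i => (1 / 2 : ℝ) ^ N i :=
  antitone_half_pow.comp_monotone hN.monotone

theorem tendsto_half_pow_comp (hN : StrictMono N) :
    Tendsto (fun i => (1 / 2 : ℝ) ^ N i) atTop (𝓝 0) :=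
  tendsto_half_pow.comp hN.tendsto_atTop

theorem binExp_eq_blockSum (hN : StrictMono N) (hN0 : N 0 = 0) {a : ℕ → ℕ} {b : ℕ → Bool}
    (ha : ∀ j, a j ≤ 1) (hab : ∀ i j, N i < j → j ≤ N (i + 1) → a j = (b i).toNat) :
    binExp a = blockSum (fun i => (1 / 2 : ℝ) ^ N i) b := by
  have hsum : Summable fun j => (a (j + 1) : ℝ) / 2 ^ (j + 1) := by
    refine Summable.of_nonneg_of_le (fun j => by positivity) (fun j => ?_)
      ((summable_nat_add_iff 1).2 summable_geometric_two)
    have : (a (j + 1) : ℝ) ≤ 1 := by exact_mod_cast ha _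
    rw [one_div_pow]
    gcongr
  have h1 := hsum.hasSum.tendsto_sum_nat.comp hN.tendsto_atTop
  have h2 := (hasSum_blockSum (antitone_half_pow_comp hN) (tendsto_half_pow_comp hN)
    b).tendsto_sum_nat
  refine tendsto_nhds_unique h1 (h2.congr fun n => ?_)
  simp only [Function.comp_apply]
  induction n with
  | zero => simp [hN0]
  | succ n ih =>
    rw [Finset.sum_range_succ, ih, ← Finset.sum_range_add_sum_Ico _ (hN (Nat.lt_succ_self n)).le]
    congr 1
    have hgeom : ∀ M, N n ≤ M → ∑ j ∈ Finset.Ico (N n) M, (1 / 2 : ℝ) ^ (j + 1) =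
        (1 / 2) ^ N n - (1 / 2) ^ M := by
      intro M hM
      induction M, hM using Nat.le_induction with
      | base => simp
      | succ M hM ihM =>
        rw [Finset.sum_Ico_succ_top hM, ihM, pow_succ]
        ring
    rw [← hgeom _ (hN (Nat.lt_succ_self n)).le, Finset.mul_sum]
    refine Finset.sum_congr rfl fun j hj => ?_
    rw [Finset.mem_Ico] at hj
    rw [hab n (j + 1) (by omega) (by simp only [Nat.succ_eq_add_one] at hj; omega), one_div_pow]
    ring

/-- The numbers whose binary digits are constant on each block `(N i, N (i + 1)]` are the block
sums for the lengths `2 ^ (-N i)`. -/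
theorem range_blockSum_half_pow (hN : StrictMono N) (hN0 : N 0 = 0) :
    Set.range (blockSum fun i => (1 / 2 : ℝ) ^ N i) =
      {x | ∃ a : ℕ → ℕ, (∀ j, a j ≤ 1) ∧ x = binExp a ∧
        ∀ i j, N i < j → j ≤ N (i + 1) → a j = a (N i + 1)} := by
  ext x
  constructor
  · rintro ⟨b, rfl⟩
    have hβ : ∀ j, ∃ k, ∀ i, N i < j → j ≤ N (i + 1) → k = i := by
      intro j
      by_cases h : ∃ k, N k < j ∧ j ≤ N (k + 1)
      · obtain ⟨k, hk, hk'⟩ := h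
        refine ⟨k, fun i hi hi' => ?_⟩
        have h1 := hN.lt_iff_lt.1 (hk.trans_le hi')
        have h2 := hN.lt_iff_lt.1 (hi.trans_le hk')
        omega
      · exact ⟨0, fun i hi hi' => (h ⟨i, hi, hi'⟩).elim⟩
    choose β hβ using hβ
    refine ⟨fun j => (b (β j)).toNat, fun j => Bool.toNat_le _, ?_, fun i j hj hj' => ?_⟩
    · exact (binExp_eq_blockSum hN hN0 (fun j => Bool.toNat_le _)
        fun i j hj hj' => by rw [hβ j i hj hj']).symm
    · have := hN (Nat.lt_succ_self i)
      simp only [hβ j i hj hj', hβ (N i + 1) i (Nat.lt_succ_self _) this]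
  · rintro ⟨a, ha, rfl, hab⟩
    refine ⟨fun i => a (N i + 1) == 1, (binExp_eq_blockSum hN hN0 ha fun i j hj hj' => ?_).symm⟩
    rw [hab i j hj hj']
    have := ha (N i + 1)
    interval_cases a (N i + 1) <;> rfl

end Blocks

/-- The number of digits in the first `i` blocks of an element of `Scube`. -/
def cubeEnd (i : ℕ) : ℕ := if i = 0 then 0 else 2 ^ i

/-- The number of digits in the first `i` blocks of an element of `Sproj`. -/
def projEnd (i : ℕ) : ℕ := if i = 0 then 0 else 2 * i + 1

theorem cubeEnd_of_ne_zero {i : ℕ} (hi : i ≠ 0) : cubeEnd i = 2 ^ i := if_neg hi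

theorem projEnd_of_ne_zero {i : ℕ} (hi : i ≠ 0) : projEnd i = 2 * i + 1 := if_neg hi

theorem strictMono_cubeEnd : StrictMono cubeEnd := by
  refine strictMono_nat_of_lt_succ fun n => ?_
  rw [cubeEnd_of_ne_zero n.succ_ne_zero]
  rcases eq_or_ne n 0 with rfl | hn
  · simp [cubeEnd]
  · rw [cubeEnd_of_ne_zero hn]
    exact Nat.pow_lt_pow_right one_lt_two n.lt_succ_self

theorem strictMono_projEnd : StrictMono projEnd := by
  refine strictMono_nat_of_lt_succ fun n => ?_
  rw [projEnd_of_ne_zero n.succ_ne_zero]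
  rcases eq_or_ne n 0 with rfl | hn
  · simp [projEnd]
  · rw [projEnd_of_ne_zero hn]
    omega

theorem Scube_eq_range : Scube = Set.range (blockSum fun i => (1 / 2 : ℝ) ^ cubeEnd i) := by
  rw [range_blockSum_half_pow strictMono_cubeEnd rfl]
  ext x
  refine exists_congr fun a => and_congr_right fun _ => and_congr_right fun _ => ?_
  constructor
  · rintro ⟨h1, h2⟩ i j hj hj'
    rcases eq_or_ne i 0 with rfl | hi
    · simp only [cubeEnd] at hj hj'
      norm_num at hj hj'
      interval_cases j <;> simp [cubeEnd, h1]
    · rw [cubeEnd_of_ne_zero hi] at hj ⊢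
      rw [cubeEnd_of_ne_zero i.succ_ne_zero] at hj'
      exact h2 (i + 1) (by omega) j _ hj hj' (Nat.lt_succ_self _)
        (Nat.pow_lt_pow_right one_lt_two i.lt_succ_self)
  · intro h
    refine ⟨(h 0 2 (by simp [cubeEnd]) (by simp [cubeEnd])).symm, fun m hm j k hj hj' hk hk' => ?_⟩
    obtain ⟨i, rfl⟩ : ∃ i, m = i + 1 := ⟨m - 1, by omega⟩
    have hi : i ≠ 0 := by omega
    have h' := h i
    rw [cubeEnd_of_ne_zero hi, cubeEnd_of_ne_zero i.succ_ne_zero] at h'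
    rw [h' j hj hj', h' k hk hk']

theorem Sproj_eq_range : Sproj = Set.range (blockSum fun i => (1 / 2 : ℝ) ^ projEnd i) := by
  rw [range_blockSum_half_pow strictMono_projEnd rfl]
  ext x
  refine exists_congr fun a => and_congr_right fun _ => and_congr_right fun _ => ?_
  constructor
  · rintro ⟨h1, h2, h3⟩ i j hj hj'
    rcases eq_or_ne i 0 with rfl | hi
    · simp only [projEnd] at hj hj'
      norm_num at hj hj'
      interval_cases j <;> simp [projEnd, h1, h2]
    · rw [projEnd_of_ne_zero hi] at hj ⊢
      rw [projEnd_of_ne_zero i.succ_ne_zero] at hj'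
      obtain rfl | rfl : j = 2 * (i + 1) ∨ j = 2 * (i + 1) + 1 := by omega
      · rfl
      · exact (h3 (i + 1) (by omega)).symm
  · intro h
    have h2 := h 0 2 (by simp [projEnd]) (by simp [projEnd])
    have h3 := h 0 3 (by simp [projEnd]) (by simp [projEnd])
    refine ⟨h2.symm, h2.trans h3.symm, fun m hm => ?_⟩
    obtain ⟨i, rfl⟩ : ∃ i, m = i + 1 := ⟨m - 1, by omega⟩
    have hi : i ≠ 0 := by omega
    have h' := h i (2 * (i + 1) + 1)
    rw [projEnd_of_ne_zero hi, projEnd_of_ne_zero i.succ_ne_zero] at h'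
    exact (h' (by omega) le_rfl).symm

theorem blockSum_half_pow_sub_nonneg {b b' : ℕ → Bool} {m : ℕ} (hlt : ∀ i < m, b i = b' i)
    (hb : b m = true) (hb' : b' m = false) :
    0 ≤ blockSum (fun n => (1 / 2 : ℝ) ^ n) b - blockSum (fun n => (1 / 2 : ℝ) ^ n) b' := by
  have := (sub_blockSum_sub_mem_Icc antitone_half_pow tendsto_half_pow hlt hb hb').2
  simp only [pow_succ] at this
  linarith

theorem monotoneOn_hproj (r : ℝ) : MonotoneOn hproj (Set.Iic (ENNReal.ofReal r)) := by
  intro x _ y hy hxy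
  have := ENNReal.toReal_mono (ne_top_of_le_ne_top ENNReal.ofReal_ne_top hy) hxy
  unfold hproj
  gcongr

theorem monotoneOn_hcube {r : ℝ} (hr : r < 1) : MonotoneOn hcube (Set.Iic (ENNReal.ofReal r)) := by
  intro x _ y hy hxy
  have hle := ENNReal.toReal_mono (ne_top_of_le_ne_top ENNReal.ofReal_ne_top hy) hxy
  have hy1 : y.toReal < 1 := by
    refine (ENNReal.toReal_mono ENNReal.ofReal_ne_top hy).trans_lt ?_
    rw [ENNReal.toReal_ofReal']
    exact max_lt hr one_pos
  unfold hcube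
  refine ENNReal.ofReal_le_ofReal ?_
  rcases (ENNReal.toReal_nonneg (a := x)).eq_or_lt with h0 | h0
  · rw [← h0]
    simp only [div_zero, Real.log_zero]
    rw [one_div, Real.log_inv]
    exact div_nonneg (Real.log_nonneg one_le_two)
      (neg_nonneg.2 (Real.log_nonpos ENNReal.toReal_nonneg hy1.le))
  · have hy0 := h0.trans_le hle
    have : 0 < Real.log (1 / y.toReal) := Real.log_pos ((one_lt_div hy0).2 hy1)
    gcongr

theorem hcube_half_pow_cubeEnd_le {n : ℕ} (hn : n ≠ 0) :
    hcube (ENNReal.ofReal ((1 / 2) ^ cubeEnd n)) ≤ ENNReal.ofReal ((1 / 2) ^ n) := by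
  rw [hcube, ENNReal.toReal_ofReal (by positivity)]
  refine ENNReal.ofReal_le_ofReal (le_of_eq ?_)
  have : Real.log 2 ≠ 0 := (Real.log_pos one_lt_two).ne'
  rw [cubeEnd_of_ne_zero hn, one_div_pow, one_div_one_div, Real.log_pow, one_div_pow]
  push_cast
  field_simp

theorem hproj_half_pow_projEnd_le {n : ℕ} (hn : n ≠ 0) :
    hproj (ENNReal.ofReal ((1 / 2) ^ projEnd n)) ≤ ENNReal.ofReal ((1 / 2) ^ n) := by
  rw [hproj, ENNReal.toReal_ofReal (by positivity)]
  refine ENNReal.ofReal_le_ofReal (Real.sqrt_le_iff.2 ⟨by positivity, le_of_eq ?_⟩)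
  rw [projEnd_of_ne_zero hn]
  ring

/-- The gauge inequality behind `μ_cube`, in terms of the relative defect `q` of the length and the
defect `τ` of the mass. -/
theorem sub_le_log_two_div_log {k : ℕ} {q τ : ℝ} (hq : 0 ≤ q) (hq2 : q ≤ 1 / 2) (hτ : 0 ≤ τ)
    (h : 4 * q ≤ 4 ^ k * τ) :
    (1 / 2) ^ k - τ ≤ Real.log 2 / Real.log (1 / ((1 / 2) ^ 2 ^ k * (1 - q))) := by
  have hl2 : (1 / 2 : ℝ) ≤ Real.log 2 := by linarith [Real.log_two_gt_d9]
  have hl2' : Real.log 2 ≤ 1 := by linarith [Real.log_two_lt_d9]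
  have h1q : 0 < 1 - q := by linarith
  have hlog : Real.log (1 / ((1 / 2) ^ 2 ^ k * (1 - q))) = 2 ^ k * Real.log 2 - Real.log (1 - q) := by
    rw [one_div, Real.log_inv, Real.log_mul (by positivity) h1q.ne', Real.log_pow, one_div,
      Real.log_inv]
    push_cast
    ring
  have hneg : -Real.log (1 - q) ≤ 2 * q := by
    have h1 := Real.log_le_sub_one_of_pos (inv_pos.2 h1q)
    rw [Real.log_inv] at h1
    have h2 : (1 - q)⁻¹ ≤ 1 + 2 * q := by
      rw [inv_le_iff_one_le_mul₀ h1q]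
      nlinarith
    linarith
  have hpos : 0 ≤ -Real.log (1 - q) := neg_nonneg.2 (Real.log_nonpos h1q.le (by linarith))
  rw [hlog]
  have h2k : (0 : ℝ) < 2 ^ k := by positivity
  have hden : 0 < 2 ^ k * Real.log 2 - Real.log (1 - q) := by
    have : 0 < 2 ^ k * Real.log 2 := by positivity
    linarith
  rw [le_div_iff₀ hden]
  have hinv : (1 / 2 : ℝ) ^ k * 2 ^ k = 1 := by rw [← mul_pow]; norm_num
  have h4 : (4 : ℝ) ^ k = 2 ^ k * 2 ^ k := by rw [← mul_pow]; norm_num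
  have hhalf : (0 : ℝ) < (1 / 2) ^ k := by positivity
  have hA : (1 / 2) ^ k * (2 * q) ≤ τ * (2 ^ k * Real.log 2) := by
    have : (1 / 2) ^ k * (4 * q) ≤ 2 ^ k * τ := by
      calc (1 / 2) ^ k * (4 * q) ≤ (1 / 2) ^ k * (4 ^ k * τ) := by gcongr
        _ = ((1 / 2) ^ k * 2 ^ k) * (2 ^ k * τ) := by rw [h4]; ring
        _ = 2 ^ k * τ := by rw [hinv, one_mul]
    have h' : 2 ^ k * τ * (1 / 2) ≤ 2 ^ k * τ * Real.log 2 := by gcongr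
    linarith
  have hB : (1 / 2) ^ k * -Real.log (1 - q) ≤ (1 / 2) ^ k * (2 * q) := by gcongr
  have hC : 0 ≤ τ * -Real.log (1 - q) := by positivity
  have hD : (1 / 2) ^ k * (2 ^ k * Real.log 2) = Real.log 2 := by rw [← mul_assoc, hinv, one_mul]
  linarith

theorem two_pow_add_le_two_pow_add {m k : ℕ} (hm : 2 ≤ m) (hk : m + 1 ≤ k) :
    2 ^ m + k + 3 ≤ 2 ^ k + 2 * m := by
  obtain ⟨i, rfl⟩ := Nat.exists_eq_add_of_le hk
  have hi : i + 1 ≤ 2 ^ i := Nat.lt_two_pow_self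
  have h4 : 4 ≤ 2 ^ m := (by norm_num : 4 = 2 ^ 2).le.trans (Nat.pow_le_pow_right two_pos hm)
  rw [pow_add, pow_succ]
  nlinarith [Nat.mul_le_mul_left (2 ^ m) hi]

theorem hcube_first_difference {b b' : ℕ → Bool} {m : ℕ} (hlt : ∀ i < m, b i = b' i)
    (hb : b m = true) (hb' : b' m = false)
    (hr : |blockSum (fun i => (1 / 2 : ℝ) ^ cubeEnd i) b -
      blockSum (fun i => (1 / 2 : ℝ) ^ cubeEnd i) b'| ≤ 1 / 10) :
    ENNReal.ofReal |blockSum (fun n => (1 / 2 : ℝ) ^ n) b - blockSum (fun n => (1 / 2 : ℝ) ^ n) b'| ≤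
      hcube (ENNReal.ofReal |blockSum (fun i => (1 / 2 : ℝ) ^ cubeEnd i) b -
        blockSum (fun i => (1 / 2 : ℝ) ^ cubeEnd i) b'|) := by
  have hℓ := antitone_half_pow_comp strictMono_cubeEnd
  have h0 := tendsto_half_pow_comp strictMono_cubeEnd
  obtain ⟨ht0, ht⟩ := sub_blockSum_sub_mem_Icc hℓ h0 hlt hb hb'
  obtain ⟨hτ0, -⟩ := sub_blockSum_sub_mem_Icc antitone_half_pow tendsto_half_pow hlt hb hb'
  have hnn := blockSum_half_pow_sub_nonneg hlt hb hb'
  have hm : 2 ≤ m := by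
    by_contra! hm
    have := (le_abs_self _).trans hr
    generalize blockSum (fun i => (1 / 2 : ℝ) ^ cubeEnd i) b -
      blockSum (fun i => (1 / 2 : ℝ) ^ cubeEnd i) b' = D at ht this
    interval_cases m <;> norm_num [cubeEnd] at ht <;> linarith
  have hkey := mul_sub_blockSum_sub_le (A := 4) (B := (1 / 2) ^ cubeEnd m * 4 ^ m) hℓ h0
    antitone_half_pow tendsto_half_pow hlt hb hb' fun k hk => by
      rw [cubeEnd_of_ne_zero (by omega : k ≠ 0), cubeEnd_of_ne_zero k.succ_ne_zero,
        cubeEnd_of_ne_zero (by omega : m ≠ 0)]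
      have h1 : (1 / 2 : ℝ) ^ (2 ^ k + 2 * m) ≤ (1 / 2) ^ (2 ^ m + k + 3) :=
        antitone_half_pow (two_pow_add_le_two_pow_add hm hk)
      have h2 : (4 : ℝ) ^ m * (1 / 2) ^ (2 * m) = 1 := by
        rw [pow_mul, ← mul_pow]
        norm_num
      have h3 : (0 : ℝ) ≤ (1 / 2) ^ 2 ^ (k + 1) := by positivity
      calc 4 * ((1 / 2 : ℝ) ^ 2 ^ k - (1 / 2) ^ 2 ^ (k + 1)) ≤ 4 * (1 / 2) ^ 2 ^ k := by linarith
        _ = 4 * (4 ^ m * (1 / 2) ^ (2 ^ k + 2 * m)) := by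
          rw [pow_add, mul_left_comm (4 ^ m), h2, mul_one]
        _ ≤ 4 * (4 ^ m * (1 / 2) ^ (2 ^ m + k + 3)) := by gcongr
        _ = _ := by rw [pow_add, pow_add]; ring
  rw [cubeEnd_of_ne_zero (by omega)] at ht0 hkey
  rw [cubeEnd_of_ne_zero (by omega), cubeEnd_of_ne_zero (by omega)] at ht
  generalize blockSum (fun i => (1 / 2 : ℝ) ^ cubeEnd i) b -
        blockSum (fun i => (1 / 2 : ℝ) ^ cubeEnd i) b' = D at *
  generalize blockSum (fun n => (1 / 2 : ℝ) ^ n) b - blockSum (fun n => (1 / 2 : ℝ) ^ n) b' = E at *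
  have hL : (0 : ℝ) < (1 / 2) ^ 2 ^ m := by positivity
  have hL4 : (1 / 2 : ℝ) ^ 2 ^ m ≤ 1 / 4 := by
    calc (1 / 2 : ℝ) ^ 2 ^ m ≤ (1 / 2) ^ 2 := antitone_half_pow
          (hm.trans (Nat.lt_two_pow_self).le)
      _ = _ := by norm_num
  have hsq : (1 / 2 : ℝ) ^ 2 ^ (m + 1) = (1 / 2) ^ 2 ^ m * (1 / 2) ^ 2 ^ m := by
    rw [← pow_add, pow_succ, mul_two]
  rw [hsq] at ht
  set L : ℝ := (1 / 2) ^ 2 ^ m with hLdef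
  have hq0 : 0 ≤ (L - D) / L := div_nonneg ht0 hL.le
  have hq2 : (L - D) / L ≤ 1 / 2 := by
    rw [div_le_iff₀ hL]
    nlinarith
  have hfin := sub_le_log_two_div_log (k := m) hq0 hq2 hτ0 (by
    rw [← mul_div_assoc, div_le_iff₀ hL]
    linarith)
  have hD : L * (1 - (L - D) / L) = D := by
    field_simp
    ring
  rw [← hLdef, hD, sub_sub_cancel] at hfin
  have hD0 : 0 ≤ D := by nlinarith
  rw [abs_of_nonneg hnn, abs_of_nonneg hD0, hcube, ENNReal.toReal_ofReal hD0]
  exact ENNReal.ofReal_le_ofReal hfin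

theorem hproj_first_difference {b b' : ℕ → Bool} {m : ℕ} (hlt : ∀ i < m, b i = b' i)
    (hb : b m = true) (hb' : b' m = false)
    (hr : |blockSum (fun i => (1 / 2 : ℝ) ^ projEnd i) b -
      blockSum (fun i => (1 / 2 : ℝ) ^ projEnd i) b'| ≤ 1 / 10) :
    ENNReal.ofReal |blockSum (fun n => (1 / 2 : ℝ) ^ n) b - blockSum (fun n => (1 / 2 : ℝ) ^ n) b'| ≤
      hproj (ENNReal.ofReal |blockSum (fun i => (1 / 2 : ℝ) ^ projEnd i) b -
        blockSum (fun i => (1 / 2 : ℝ) ^ projEnd i) b'|) := by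
  have hℓ := antitone_half_pow_comp strictMono_projEnd
  have h0 := tendsto_half_pow_comp strictMono_projEnd
  obtain ⟨ht0, ht⟩ := sub_blockSum_sub_mem_Icc hℓ h0 hlt hb hb'
  obtain ⟨hτ0, -⟩ := sub_blockSum_sub_mem_Icc antitone_half_pow tendsto_half_pow hlt hb hb'
  have hnn := blockSum_half_pow_sub_nonneg hlt hb hb'
  have hm : m ≠ 0 := by
    rintro rfl
    have := (le_abs_self _).trans hr
    generalize blockSum (fun i => (1 / 2 : ℝ) ^ projEnd i) b -
      blockSum (fun i => (1 / 2 : ℝ) ^ projEnd i) b' = D at ht this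
    norm_num [projEnd] at ht
    linarith
  have hkey := mul_sub_blockSum_sub_le (A := 2) (B := (1 / 2) ^ m * (3 / 4)) hℓ h0
    antitone_half_pow tendsto_half_pow hlt hb hb' fun k hk => by
      obtain ⟨i, rfl⟩ := Nat.exists_eq_add_of_le hk
      rw [projEnd_of_ne_zero (by omega), projEnd_of_ne_zero (by omega)]
      have hi : (1 / 2 : ℝ) ^ i ≤ 1 := pow_le_one₀ (by norm_num) (by norm_num)
      have hp : (0 : ℝ) ≤ (1 / 2) ^ m * (1 / 2) ^ m * (1 / 2) ^ i := by positivity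
      have := mul_le_mul_of_nonneg_left hi hp
      have h1 : 2 * (m + 1 + i) + 1 = m + m + i + i + 3 := by ring
      have h2 : 2 * (m + 1 + i + 1) + 1 = m + m + i + i + 5 := by ring
      rw [h1, h2]
      simp only [pow_add]
      linarith
  rw [projEnd_of_ne_zero hm] at ht0 hkey
  rw [projEnd_of_ne_zero hm, projEnd_of_ne_zero (by omega)] at ht
  generalize blockSum (fun i => (1 / 2 : ℝ) ^ projEnd i) b -
        blockSum (fun i => (1 / 2 : ℝ) ^ projEnd i) b' = D at *
  generalize blockSum (fun n => (1 / 2 : ℝ) ^ n) b - blockSum (fun n => (1 / 2 : ℝ) ^ n) b' = E at *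
  have e1 : (1 / 2 : ℝ) ^ (2 * m + 1) = (1 / 2) ^ m * (1 / 2) ^ m / 2 := by
    rw [pow_succ, two_mul, pow_add]; ring
  have e2 : (1 / 2 : ℝ) ^ (2 * (m + 1) + 1) = (1 / 2) ^ m * (1 / 2) ^ m / 8 := by
    rw [show 2 * (m + 1) + 1 = m + m + 3 by ring, pow_add, pow_add]; ring
  rw [e1, e2] at ht
  rw [e1] at hkey
  have hL : (0 : ℝ) < (1 / 2) ^ m := by positivity
  generalize (1 / 2 : ℝ) ^ m = L at *
  have hD0 : 0 ≤ D := by nlinarith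
  rw [abs_of_nonneg hnn, abs_of_nonneg hD0, hproj, ENNReal.toReal_ofReal hD0]
  refine ENNReal.ofReal_le_ofReal (Real.le_sqrt_of_sq_le ?_)
  nlinarith

/-- The sets `S_cube` and `S_proj` are compact, and they have measure `1`
with respect to the Hausdorff-type measures with gauges `h_cube` and `h_proj`
respectively. -/
theorem stmt18 :
    IsCompact Scube ∧ IsCompact Sproj ∧ mucube Scube = 1 ∧ muproj Sproj = 1 := by
  have hc := antitone_half_pow_comp strictMono_cubeEnd
  have hc0 := tendsto_half_pow_comp strictMono_cubeEnd
  have hp := antitone_half_pow_comp strictMono_projEnd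
  have hp0 := tendsto_half_pow_comp strictMono_projEnd
  rw [Scube_eq_range, Sproj_eq_range]
  refine ⟨isCompact_range_blockSum hc hc0, isCompact_range_blockSum hp hp0,
    le_antisymm (mkMetric_range_blockSum_le hc hc0 fun _ => hcube_half_pow_cubeEnd_le) ?_,
    le_antisymm (mkMetric_range_blockSum_le hp hp0 fun _ => hproj_half_pow_projEnd_le) ?_⟩
  · exact one_le_mkMetric_range_blockSum (r := 1 / 10) (by norm_num)
      (monotoneOn_hcube (by norm_num)) (forall_abs_blockSum_sub_of_first_difference
        fun b b' m hlt hb hb' hr => hcube_first_difference hlt hb hb' hr)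
  · exact one_le_mkMetric_range_blockSum (r := 1 / 10) (by norm_num)
      (monotoneOn_hproj _) (forall_abs_blockSum_sub_of_first_difference
        fun b b' m hlt hb hb' hr => hproj_first_difference hlt hb hb' hr)
end
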